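/- Consider the unit-noise Gaussian sequence model on ℝᵐ and the symmetric spike prior π_S^{μ,m}. For sequences mₙ → ∞ and μₙ → ∞ with μₙ = o(√(log mₙ)), the Bayes risk satisfies B(π_S^{μₙ,mₙ}) ≥ μₙ² [ 1 − (e^{μₙ²}/(2mₙ))(1+o(1)) ]; that is, there exists a sequence cₙ → 1 such that B(π_S^{μₙ,mₙ}) ≥ μₙ² (1 − cₙ·e^{μₙ²}/(2mₙ)) for all n. -/

import Mathlib

open MeasureTheory ProbabilityTheory Filter
open scoped ENNReal NNReal Topology

noncomputable section

/-- Unit-noise Gaussian sequence model on `ℝᵐ`: the law of `y` under parameter `θ`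
(product of `N(θ i, σ²)`; we use it with `σ = 1`). -/
def gsm (m : ℕ) (θ : Fin m → ℝ) (σ : ℝ) : Measure (Fin m → ℝ) :=
  MeasureTheory.Measure.pi fun i => gaussianReal (θ i) ((σ ^ 2).toNNReal)

/-- Squared-error risk `E_θ ‖est(y) − θ‖₂²` of an estimator at parameter `θ`. -/
def risk (m : ℕ) (σ : ℝ) (est : (Fin m → ℝ) → Fin m → ℝ) (θ : Fin m → ℝ) : ℝ≥0∞ :=
  ∫⁻ y, ENNReal.ofReal (∑ i, (est y i - θ i) ^ 2) ∂(gsm m θ σ)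

/-- Bayes risk of a prior `π` on `ℝᵐ` in the unit-noise Gaussian sequence model:
the infimum over measurable estimators of the integrated risk. -/
def bayesRisk (m : ℕ) (π : Measure (Fin m → ℝ)) : ℝ≥0∞ :=
  ⨅ (est : (Fin m → ℝ) → Fin m → ℝ) (_ : Measurable est),
    ∫⁻ θ, risk m 1 est θ ∂π

/-- Symmetric spike prior `π_S^{μ,m}`: mass `1/(2m)` at each of the `2m` points `±μ eᵢ`. -/
def spikePrior (m : ℕ) (μ : ℝ) : Measure (Fin m → ℝ) :=
  (2 * (m : ℝ≥0∞))⁻¹ • ∑ i : Fin m,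
    (Measure.dirac (fun j => if j = i then μ else 0) +
      Measure.dirac (fun j => if j = i then -μ else 0))


lemma gauss_tilt (t : ℝ) : gaussianReal t 1 =
    (gaussianReal 0 1).withDensity (fun x => ENNReal.ofReal (Real.exp (t * x - t ^ 2 / 2))) := by
  rw [gaussianReal_of_var_ne_zero t one_ne_zero, gaussianReal_of_var_ne_zero 0 one_ne_zero,
    ← withDensity_mul _ (measurable_gaussianPDF 0 1) (by fun_prop)]
  congr 1
  ext x
  simp only [gaussianPDF, Pi.mul_apply]
  rw [← ENNReal.ofReal_mul (gaussianPDFReal_nonneg _ _ _)]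
  congr 1
  simp only [gaussianPDFReal]
  rw [mul_assoc (√(2 * Real.pi * ((1 : ℝ≥0) : ℝ)))⁻¹, ← Real.exp_add]
  congr 2
  simp
  ring

lemma gsm_tilt (m : ℕ) (θ : Fin m → ℝ) : gsm m θ 1 =
    (gsm m 0 1).withDensity
      (fun y => ∏ i, ENNReal.ofReal (Real.exp (θ i * y i - θ i ^ 2 / 2))) := by
  have h1 : ((1:ℝ) ^ 2).toNNReal = 1 := by simp
  unfold gsm
  simp only [h1, Pi.zero_apply]
  apply Measure.pi_eq
  intro s hs
  have hms : MeasurableSet (Set.univ.pi s) := MeasurableSet.univ_pi hs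
  rw [withDensity_apply _ hms, ← lintegral_indicator hms]
  set f : Fin m → ℝ → ℝ≥0∞ := fun i => (s i).indicator
    (fun x => ENNReal.ofReal (Real.exp (θ i * x - θ i ^ 2 / 2))) with hf
  have hfm : ∀ i, Measurable (f i) := fun i => Measurable.indicator (by fun_prop) (hs i)
  have hind := iIndepFun_pi (μ := fun _ : Fin m => gaussianReal 0 1) (X := f)
    (fun i => (hfm i).aemeasurable)
  have := lintegral_prod_eq_prod_lintegral_of_indepFun Finset.univ _ hind
    (fun i => (hfm i).comp (measurable_pi_apply i))
  trans ∫⁻ y, ∏ i, f i (y i) ∂(Measure.pi fun _ : Fin m => gaussianReal 0 1)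
  · congr 1
    ext y
    by_cases hy : y ∈ Set.univ.pi s
    · rw [Set.indicator_of_mem hy]
      refine Finset.prod_congr rfl fun i _ => ?_
      simp only [hf]
      rw [Set.indicator_of_mem (hy i trivial)]
    · rw [Set.indicator_of_notMem hy]
      simp only [Set.mem_pi, Set.mem_univ, true_implies, not_forall] at hy
      obtain ⟨i, hi⟩ := hy
      symm
      apply Finset.prod_eq_zero (Finset.mem_univ i)
      simp only [hf]
      rw [Set.indicator_of_notMem hi]
  · rw [this]
    refine Finset.prod_congr rfl fun i _ => ?_
    rw [(measurePreserving_eval (fun _ : Fin m => gaussianReal 0 1) i).lintegral_comp (hfm i)]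
    rw [gauss_tilt (θ i), withDensity_apply _ (hs i), ← lintegral_indicator (hs i)]

lemma gsm_spike (m : ℕ) (i : Fin m) (t : ℝ) : gsm m (fun j => if j = i then t else 0) 1 =
    (gsm m 0 1).withDensity
      (fun y => ENNReal.ofReal (Real.exp (t * y i - t ^ 2 / 2))) := by
  rw [gsm_tilt]
  congr 1
  ext y
  rw [Finset.prod_eq_single i]
  · simp
  · intro b _ hb
    simp [hb]
  · simp

instance (m : ℕ) (θ : Fin m → ℝ) (σ : ℝ) : IsProbabilityMeasure (gsm m θ σ) := by
  unfold gsm; infer_instance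

lemma key {Ω : Type*} [MeasurableSpace Ω] (P : Measure Ω) [IsProbabilityMeasure P]
    (m : ℕ) (hm : 2 ≤ m) (X : Fin m → Ω → ℝ) (hX : ∀ j, Measurable (X j))
    (hind : iIndepFun X P) (hL : ∀ j, MemLp (X j) 2 P) (a b : ℝ) (ha : 0 < a)
    (hEa : ∀ j, ∫ w, X j w ∂P = a) (hEb : ∀ j, ∫ w, X j w ^ 2 ∂P = b) (i : Fin m)
    (A : ℝ) (hA : A = (m - 1) * a) :
    Integrable (fun w => (X i w ^ 2 - 1) * (1 / A - (∑ j ∈ Finset.univ.erase i, X j w - A) / A ^ 2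
        + (∑ j ∈ Finset.univ.erase i, X j w - A) ^ 2 / (A ^ 2 * (m - 1)))) P ∧
    ∫ w, (X i w ^ 2 - 1) * (1 / A - (∑ j ∈ Finset.univ.erase i, X j w - A) / A ^ 2
        + (∑ j ∈ Finset.univ.erase i, X j w - A) ^ 2 / (A ^ 2 * (m - 1))) ∂P
      = (b - 1) * (1 / A + (b - a ^ 2) / A ^ 2) := by
  have hm' : (2:ℝ) ≤ m := by exact_mod_cast hm
  have hm1 : (0:ℝ) < m - 1 := by linarith
  have hA0 : 0 < A := by rw [hA]; positivity
  have hcard : ((Finset.univ.erase i).card : ℝ) = m - 1 := by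
    rw [Finset.card_erase_of_mem (Finset.mem_univ i), Finset.card_univ, Fintype.card_fin,
      Nat.cast_sub (by omega)]; simp
  set S : Ω → ℝ := ∑ j ∈ Finset.univ.erase i, X j with hS
  have hSx : ∀ w, ∑ j ∈ Finset.univ.erase i, X j w = S w := fun w => by simp [hS]
  simp only [hSx]
  have hSL : MemLp S 2 P := memLp_finsetSum' _ fun j _ => hL j
  have hSm : Measurable S := by
    have : S = fun w => ∑ j ∈ Finset.univ.erase i, X j w := funext fun w => (hSx w).symm
    rw [this]; exact Finset.measurable_sum _ fun j _ => hX j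
  have hES : ∫ w, S w ∂P = A := by
    simp only [← hSx]
    rw [integral_finsetSum _ fun j _ => (hL j).integrable one_le_two]
    simp only [hEa, Finset.sum_const, nsmul_eq_mul, hcard, hA]
  have hVS : ∫ w, (S w - A) ^ 2 ∂P = (m - 1) * (b - a ^ 2) := by
    have h1 := variance_eq_integral (μ := P) hSm.aemeasurable
    rw [hES] at h1
    rw [← h1, hS, IndepFun.variance_sum (fun j _ => hL j)
      (fun j _ k _ hjk => hind.indepFun hjk)]
    have : ∀ j, Var[X j; P] = b - a ^ 2 := fun j => by
      rw [variance_eq_sub (hL j), hEa]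
      congr 1
      exact hEb j
    simp only [this, Finset.sum_const, nsmul_eq_mul, hcard]
  have hI : IndepFun S (X i) P := hind.indepFun_finsetSum_of_notMem hX (by simp)
  have hI2 : IndepFun (fun w => X i w ^ 2 - 1) (fun w => 1 / A - (S w - A) / A ^ 2
        + (S w - A) ^ 2 / (A ^ 2 * (m - 1))) P :=
    hI.symm.comp (φ := fun x : ℝ => x ^ 2 - 1)
      (ψ := fun s : ℝ => 1 / A - (s - A) / A ^ 2 + (s - A) ^ 2 / (A ^ 2 * (m - 1)))
      (by fun_prop) (by fun_prop)
  have i1 : Integrable (fun w => X i w ^ 2) P := (hL i).integrable_sq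
  have i2 : Integrable (fun w => S w - A) P :=
    (hSL.integrable one_le_two).sub (integrable_const _)
  have i3 : Integrable (fun w => (S w - A) ^ 2) P := (hSL.sub (memLp_const A)).integrable_sq
  have i4 : Integrable (fun w => X i w ^ 2 - 1) P := i1.sub (integrable_const _)
  have i6 : Integrable (fun w => 1 / A - (S w - A) / A ^ 2) P :=
    (integrable_const _).sub (i2.div_const _)
  have i5 : Integrable (fun w => 1 / A - (S w - A) / A ^ 2
        + (S w - A) ^ 2 / (A ^ 2 * (m - 1))) P := i6.add (i3.div_const _)
  refine ⟨hI2.integrable_mul i4 i5, ?_⟩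
  have := hI2.integral_mul_eq_mul_integral i4.aestronglyMeasurable i5.aestronglyMeasurable
  simp only [Pi.mul_apply] at this
  rw [this, integral_sub i1 (integrable_const _), integral_add i6 (i3.div_const _),
    integral_sub (integrable_const _) (i2.div_const _), integral_div, integral_div, integral_div, hVS,
    integral_sub (hSL.integrable one_le_two) (integrable_const _), hES, hEb]
  simp
  left
  field_simp

lemma cosh_mom (t : ℝ) : Integrable (fun x => Real.cosh (t * x)) (gaussianReal 0 1) ∧
    ∫ x, Real.cosh (t * x) ∂(gaussianReal 0 1) = Real.exp (t ^ 2 / 2) := by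
  have h : ∀ s : ℝ, ∫ x, Real.exp (s * x) ∂(gaussianReal 0 1) = Real.exp (s ^ 2 / 2) := by
    intro s
    have := congrFun (mgf_id_gaussianReal (μ := 0) (v := 1)) s
    simpa [mgf] using this
  have e : (fun x => Real.cosh (t * x)) = fun x => (Real.exp (t * x) + Real.exp ((-t) * x)) / 2 := by
    ext x; rw [Real.cosh_eq]; ring_nf
  have j1 := integrable_exp_mul_gaussianReal (μ := 0) (v := 1) t
  have j2 := integrable_exp_mul_gaussianReal (μ := 0) (v := 1) (-t)
  rw [e]
  refine ⟨(j1.add j2).div_const _, ?_⟩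
  rw [integral_div, integral_add j1 j2, h, h]
  ring_nf

lemma cosh_sq_mom (t : ℝ) : Integrable (fun x => Real.cosh (t * x) ^ 2) (gaussianReal 0 1) ∧
    ∫ x, Real.cosh (t * x) ^ 2 ∂(gaussianReal 0 1) = (Real.exp (2 * t ^ 2) + 1) / 2 := by
  obtain ⟨h1, h2⟩ := cosh_mom (2 * t)
  have e : (fun x => Real.cosh (t * x) ^ 2) = fun x => (Real.cosh (2 * t * x) + 1) / 2 := by
    ext x
    have := Real.cosh_two_mul (t * x)
    have h3 := Real.cosh_sq (t * x)
    rw [mul_assoc]; linarith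
  rw [e]
  refine ⟨(h1.add (integrable_const _)).div_const _, ?_⟩
  rw [integral_div, integral_add h1 (integrable_const _), h2]
  simp
  ring_nf

/-- pointwise completion of the square -/
lemma pointwise (m : ℕ) (hm : 2 ≤ m) (t A : ℝ) (hA : 0 < A) (d y : Fin m → ℝ) :
    2 * t ^ 2 * (∑ i, Real.cosh (t * y i) - ∑ i, (Real.cosh (t * y i) ^ 2 - 1) *
      (1 / A - (∑ j ∈ Finset.univ.erase i, Real.cosh (t * y j) - A) / A ^ 2
        + (∑ j ∈ Finset.univ.erase i, Real.cosh (t * y j) - A) ^ 2 / (A ^ 2 * (m - 1))))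
    ≤ ∑ i, (Real.exp (t * y i) * ∑ j, (d j - if j = i then t else 0) ^ 2 +
        Real.exp (-t * y i) * ∑ j, (d j - if j = i then -t else 0) ^ 2) := by
  have hm' : (2:ℝ) ≤ m := by exact_mod_cast hm
  have hm1 : (0:ℝ) < m - 1 := by linarith
  set C := ∑ i, Real.cosh (t * y i) with hC
  have hCpos : 0 < C := by
    apply Finset.sum_pos (fun i _ => Real.cosh_pos _)
    exact ⟨⟨0, by omega⟩, Finset.mem_univ _⟩
  have hcard : ∀ i : Fin m, ((Finset.univ.erase i).card : ℝ) = m - 1 := fun i => by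
    rw [Finset.card_erase_of_mem (Finset.mem_univ i), Finset.card_univ, Fintype.card_fin,
      Nat.cast_sub (by omega)]; simp
  have hsum : ∀ (i : Fin m) (s : ℝ), ∑ j, (d j - if j = i then s else 0) ^ 2
      = ∑ j, d j ^ 2 - 2 * s * d i + s ^ 2 := by
    intro i s
    have : ∀ j, (d j - if j = i then s else 0) ^ 2
      = d j ^ 2 - (if j = i then 2 * s * d i - s ^ 2 else 0) := by
      intro j
      split_ifs with h
      · subst h; ring
      · ring
    simp only [this, Finset.sum_sub_distrib, Finset.sum_ite_eq', Finset.mem_univ, if_true]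
    ring
  have hR : ∑ i, (Real.exp (t * y i) * ∑ j, (d j - if j = i then t else 0) ^ 2 +
        Real.exp (-t * y i) * ∑ j, (d j - if j = i then -t else 0) ^ 2)
      = 2 * C * ∑ j, d j ^ 2 - 4 * t * ∑ i, d i * Real.sinh (t * y i) + 2 * t ^ 2 * C := by
    rw [hC, Finset.mul_sum Finset.univ _ (4 * t), Finset.mul_sum Finset.univ _ (2 * t ^ 2),
      Finset.mul_sum Finset.univ _ 2, Finset.sum_mul, ← Finset.sum_sub_distrib,
      ← Finset.sum_add_distrib]
    refine Finset.sum_congr rfl fun i _ => ?_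
    rw [hsum, hsum, Real.cosh_eq, Real.sinh_eq, neg_mul]
    ring
  rw [hR]
  have hbd : ∀ i, Real.sinh (t * y i) ^ 2 / C ≤ (Real.cosh (t * y i) ^ 2 - 1) *
      (1 / A - (∑ j ∈ Finset.univ.erase i, Real.cosh (t * y j) - A) / A ^ 2
        + (∑ j ∈ Finset.univ.erase i, Real.cosh (t * y j) - A) ^ 2 / (A ^ 2 * (m - 1))) := by
    intro i
    rw [Real.cosh_sq, add_sub_cancel_right, div_eq_mul_inv]
    refine mul_le_mul_of_nonneg_left ?_ (sq_nonneg _)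
    set S := ∑ j ∈ Finset.univ.erase i, Real.cosh (t * y j) with hS
    have h1 : (m:ℝ) - 1 ≤ S := by
      rw [← hcard i, hS, Finset.cast_card]
      exact Finset.sum_le_sum fun j _ => Real.one_le_cosh _
    have hSp : 0 < S := by linarith
    have h2 : S ≤ C := by
      rw [hC, ← Finset.add_sum_erase _ _ (Finset.mem_univ i)]
      linarith [Real.cosh_pos (t * y i)]
    calc C⁻¹ ≤ S⁻¹ := inv_anti₀ hSp h2
      _ = 1 / A - (S - A) / A ^ 2 + (S - A) ^ 2 / (A ^ 2 * S) := by field_simp; ring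
      _ ≤ _ := by gcongr
  have hsumbd := Finset.sum_le_sum fun i (_ : i ∈ Finset.univ) => hbd i
  have hsq : ∀ i, 0 ≤ C * d i ^ 2 - 2 * t * (d i * Real.sinh (t * y i))
      + t ^ 2 * (Real.sinh (t * y i) ^ 2 / C) := by
    intro i
    have : C * d i ^ 2 - 2 * t * (d i * Real.sinh (t * y i))
      + t ^ 2 * (Real.sinh (t * y i) ^ 2 / C) = (C * d i - t * Real.sinh (t * y i)) ^ 2 / C := by
      field_simp; ring
    rw [this]; positivity
  have hsq' := Finset.sum_nonneg fun i (_ : i ∈ Finset.univ) => hsq i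
  rw [Finset.sum_add_distrib, Finset.sum_sub_distrib, ← Finset.mul_sum, ← Finset.mul_sum,
    ← Finset.mul_sum] at hsq'
  nlinarith [mul_le_mul_of_nonneg_left hsumbd (sq_nonneg t)]

lemma ofReal_integral_le {Ω : Type*} [MeasurableSpace Ω] (P : Measure Ω) (f : Ω → ℝ)
    (hf : Integrable f P) : ENNReal.ofReal (∫ w, f w ∂P) ≤ ∫⁻ w, ENNReal.ofReal (f w) ∂P := by
  rw [integral_eq_lintegral_pos_part_sub_lintegral_neg_part hf]
  refine (ENNReal.ofReal_le_ofReal (sub_le_self _ ENNReal.toReal_nonneg)).trans ?_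
  exact ENNReal.ofReal_toReal_le

lemma risk_spike (m : ℕ) (i : Fin m) (s : ℝ) (est : (Fin m → ℝ) → Fin m → ℝ)
    (hest : Measurable est) :
    risk m 1 est (fun j => if j = i then s else 0) =
      ∫⁻ y, ENNReal.ofReal (Real.exp (-(s ^ 2 / 2)) * (Real.exp (s * y i) *
        ∑ j, (est y j - if j = i then s else 0) ^ 2)) ∂(gsm m 0 1) := by
  unfold risk
  rw [gsm_spike, lintegral_withDensity_eq_lintegral_mul _ (by fun_prop) (by fun_prop)]
  refine lintegral_congr fun y => ?_
  rw [Pi.mul_apply, ← ENNReal.ofReal_mul (Real.exp_nonneg _), ← mul_assoc, ← Real.exp_add]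
  congr 3
  ring_nf

lemma bayes_eq (m : ℕ) (hm : 1 ≤ m) (t : ℝ) (est : (Fin m → ℝ) → Fin m → ℝ)
    (hest : Measurable est) :
    ∫⁻ θ, risk m 1 est θ ∂(spikePrior m t) =
      ∫⁻ y, ENNReal.ofReal (Real.exp (-(t ^ 2 / 2)) / (2 * m) *
       ∑ i, (Real.exp (t * y i) * ∑ j, (est y j - if j = i then t else 0) ^ 2 +
        Real.exp (-t * y i) * ∑ j, (est y j - if j = i then -t else 0) ^ 2)) ∂(gsm m 0 1) := by
  unfold spikePrior
  have hm0 : (0:ℝ) < m := by exact_mod_cast hm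
  have hc : (2 * (m : ℝ≥0∞))⁻¹ = ENNReal.ofReal (1 / (2 * m)) := by
    rw [one_div, ENNReal.ofReal_inv_of_pos (by positivity), ENNReal.ofReal_mul (by norm_num)]
    simp
  have hp : ∀ (i : Fin m) (s : ℝ) (y : Fin m → ℝ), 0 ≤ Real.exp (-(s ^ 2 / 2)) *
      (Real.exp (s * y i) * ∑ j, (est y j - if j = i then s else 0) ^ 2) := fun i s y => by
    have : 0 ≤ ∑ j, (est y j - if j = i then s else 0) ^ 2 :=
      Finset.sum_nonneg fun _ _ => sq_nonneg _
    positivity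
  have hmeas : ∀ (i : Fin m) (s : ℝ), Measurable fun y : Fin m → ℝ =>
      ENNReal.ofReal (Real.exp (-(s ^ 2 / 2)) *
      (Real.exp (s * y i) * ∑ j, (est y j - if j = i then s else 0) ^ 2)) := fun i s => by
    fun_prop
  have hmeas2 : ∀ i : Fin m, Measurable fun y : Fin m → ℝ =>
      ENNReal.ofReal (Real.exp (-(t ^ 2 / 2)) *
        (Real.exp (t * y i) * ∑ j, (est y j - if j = i then t else 0) ^ 2)) +
      ENNReal.ofReal (Real.exp (-((-t) ^ 2 / 2)) *
        (Real.exp (-t * y i) * ∑ j, (est y j - if j = i then -t else 0) ^ 2)) :=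
    fun i => (hmeas i t).add (hmeas i (-t))
  rw [lintegral_smul_measure, lintegral_finsetSum_measure]
  simp only [lintegral_add_measure, lintegral_dirac, risk_spike m _ _ est hest]
  simp_rw [← lintegral_add_left (hmeas _ _)]
  rw [← lintegral_finsetSum _ (fun i _ => hmeas2 i), smul_eq_mul,
    ← lintegral_const_mul _ (Finset.measurable_sum _ fun i _ => hmeas2 i)]
  refine lintegral_congr fun y => ?_
  simp_rw [← ENNReal.ofReal_add (hp _ _ y) (hp _ _ y)]
  rw [← ENNReal.ofReal_sum_of_nonneg (fun i _ => add_nonneg (hp _ _ y) (hp _ _ y)), hc,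
    ← ENNReal.ofReal_mul (by positivity)]
  congr 1
  rw [neg_sq]
  simp_rw [← mul_add]
  rw [← Finset.mul_sum]
  ring

lemma bayes_lower (m : ℕ) (hm : 2 ≤ m) (t : ℝ) :
    ENNReal.ofReal (t ^ 2 * (1 - ((m:ℝ) / (m - 1) * (1 + Real.exp (3 / 2 * t ^ 2) / (m - 1)))
      * Real.exp (t ^ 2) / (2 * m))) ≤ bayesRisk m (spikePrior m t) := by
  have hm' : (2:ℝ) ≤ m := by exact_mod_cast hm
  have hm1 : (0:ℝ) < m - 1 := by linarith
  unfold _root_.bayesRisk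
  refine le_iInf₂ fun est hest => ?_
  rw [bayes_eq m (by omega) t est hest]
  set a := Real.exp (t ^ 2 / 2) with ha
  set b := (Real.exp (2 * t ^ 2) + 1) / 2 with hb
  have ha0 : 0 < a := Real.exp_pos _
  set A := ((m:ℝ) - 1) * a with hA
  have hA0 : 0 < A := by positivity
  set X : Fin m → (Fin m → ℝ) → ℝ := fun j y => Real.cosh (t * y j) with hX
  have hXm : ∀ j, Measurable (X j) := fun j =>
    Real.continuous_cosh.measurable.comp (by fun_prop)
  have hpres : ∀ j : Fin m, MeasurePreserving (Function.eval j) (gsm m 0 1) (gaussianReal 0 1) := by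
    intro j
    have := measurePreserving_eval (fun _ : Fin m => gaussianReal 0 1) j
    simpa [gsm] using this
  have hcm : Measurable fun x : ℝ => Real.cosh (t * x) :=
    Real.continuous_cosh.measurable.comp (by fun_prop)
  have hind : iIndepFun X (gsm m 0 1) := by
    unfold gsm
    exact iIndepFun_pi (X := fun _ x => Real.cosh (t * x)) (fun i => hcm.aemeasurable)
  have hI1 : ∀ j, Integrable (X j) (gsm m 0 1) := fun j =>
    (hpres j).integrable_comp_of_integrable (cosh_mom t).1
  have hI2 : ∀ j, Integrable (fun y => X j y ^ 2) (gsm m 0 1) := fun j =>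
    (hpres j).integrable_comp_of_integrable (cosh_sq_mom t).1
  have hL : ∀ j, MemLp (X j) 2 (gsm m 0 1) := fun j =>
    (memLp_two_iff_integrable_sq (hXm j).aestronglyMeasurable).2 (hI2 j)
  have hEa : ∀ j, ∫ w, X j w ∂(gsm m 0 1) = a := fun j => by
    rw [ha, ← (cosh_mom t).2, ← (hpres j).map_eq,
      integral_map (hpres j).measurable.aemeasurable hcm.aestronglyMeasurable]
  have hEb : ∀ j, ∫ w, X j w ^ 2 ∂(gsm m 0 1) = b := fun j => by
    rw [hb, ← (cosh_sq_mom t).2, ← (hpres j).map_eq,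
      integral_map (hpres j).measurable.aemeasurable (hcm.pow_const 2).aestronglyMeasurable]
  have hk := fun i => key (gsm m 0 1) m hm X hXm hind hL a b ha0 hEa hEb i A hA
  set F : (Fin m → ℝ) → ℝ := fun y => Real.exp (-(t ^ 2 / 2)) / (2 * m) * (2 * t ^ 2 *
    (∑ i, X i y - ∑ i, (X i y ^ 2 - 1) *
      (1 / A - (∑ j ∈ Finset.univ.erase i, X j y - A) / A ^ 2
        + (∑ j ∈ Finset.univ.erase i, X j y - A) ^ 2 / (A ^ 2 * (m - 1))))) with hF
  have s1 : Integrable (fun y => ∑ i, X i y) (gsm m 0 1) := integrable_finsetSum _ fun i _ => hI1 i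
  have s2 := integrable_finsetSum Finset.univ fun i _ => (hk i).1
  have hFi : Integrable F (gsm m 0 1) := ((s1.sub s2).const_mul _).const_mul _
  have hle : ∫⁻ y, ENNReal.ofReal (F y) ∂(gsm m 0 1) ≤
      ∫⁻ y, ENNReal.ofReal (Real.exp (-(t ^ 2 / 2)) / (2 * m) *
       ∑ i, (Real.exp (t * y i) * ∑ j, (est y j - if j = i then t else 0) ^ 2 +
        Real.exp (-t * y i) * ∑ j, (est y j - if j = i then -t else 0) ^ 2)) ∂(gsm m 0 1) := by
    refine lintegral_mono fun y => ENNReal.ofReal_le_ofReal ?_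
    exact mul_le_mul_of_nonneg_left (pointwise m hm t A hA0 (est y) y) (by positivity)
  refine le_trans ?_ ((ofReal_integral_le _ F hFi).trans hle)
  apply ENNReal.ofReal_le_ofReal
  have hFint : ∫ y, F y ∂(gsm m 0 1) = a⁻¹ / (2 * m) * (2 * t ^ 2 *
      (m * a - m * ((b - 1) * (1 / A + (b - a ^ 2) / A ^ 2)))) := by
    rw [hF, integral_const_mul, integral_const_mul, integral_sub s1 s2,
      integral_finsetSum _ (fun i _ => hI1 i), integral_finsetSum _ (fun i _ => (hk i).1)]
    simp only [(hk _).2, hEa, Finset.sum_const, Finset.card_univ, Fintype.card_fin, nsmul_eq_mul]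
    rw [Real.exp_neg]
  rw [hFint]
  have e1 : Real.exp (t ^ 2) = a ^ 2 := by rw [ha, ← Real.exp_nat_mul]; congr 1; push_cast; ring
  have e2 : Real.exp (3 / 2 * t ^ 2) = a ^ 3 := by
    rw [ha, ← Real.exp_nat_mul]; congr 1; push_cast; ring
  have e3 : Real.exp (2 * t ^ 2) = a ^ 4 := by
    rw [ha, ← Real.exp_nat_mul]; congr 1; push_cast; ring
  have ha1 : 1 ≤ a := Real.one_le_exp (by positivity)
  have hb' : b = (a ^ 4 + 1) / 2 := by rw [hb, e3]
  have ha4 : 1 ≤ a ^ 4 := one_le_pow₀ ha1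
  have hK : (b - 1) * (1 / A + (b - a ^ 2) / A ^ 2) ≤ a ^ 4 / 2 * (1 / A + a ^ 4 / A ^ 2) := by
    have h1 : b - 1 ≤ a ^ 4 / 2 := by rw [hb']; linarith
    have h2 : b - a ^ 2 ≤ a ^ 4 := by rw [hb']; nlinarith [sq_nonneg a]
    have h3 : 0 ≤ b - a ^ 2 := by rw [hb']; nlinarith [sq_nonneg (a ^ 2 - 1)]
    have h4 : 0 ≤ b - 1 := by rw [hb']; linarith
    gcongr
  have hfin : a⁻¹ / (2 * m) * (2 * t ^ 2 * (m * a - m * ((b - 1) * (1 / A + (b - a ^ 2) / A ^ 2))))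
      = t ^ 2 * (1 - a⁻¹ * ((b - 1) * (1 / A + (b - a ^ 2) / A ^ 2))) := by
    field_simp
  rw [hfin, e1, e2]
  refine mul_le_mul_of_nonneg_left ?_ (sq_nonneg t)
  have h5 := mul_le_mul_of_nonneg_left hK (inv_nonneg.2 ha0.le)
  have h6 : a⁻¹ * (a ^ 4 / 2 * (1 / A + a ^ 4 / A ^ 2)) =
      (m:ℝ) / (m - 1) * (1 + a ^ 3 / (m - 1)) * a ^ 2 / (2 * m) := by
    rw [hA]; field_simp
  linarith

theorem statement15
    (m : ℕ → ℕ) (μ : ℕ → ℝ)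
    (hm1 : ∀ n, 1 ≤ m n) (hμpos : ∀ n, 0 < μ n)
    (hmtop : Tendsto m atTop atTop) (hμtop : Tendsto μ atTop atTop)
    (hμo : Tendsto (fun n => μ n / Real.sqrt (Real.log (m n))) atTop (𝓝 0)) :
    ∃ c : ℕ → ℝ, Tendsto c atTop (𝓝 1) ∧
      ∀ n : ℕ,
        ENNReal.ofReal (μ n ^ 2 * (1 - c n * Real.exp (μ n ^ 2) / (2 * m n))) ≤
          bayesRisk (m n) (spikePrior (m n) (μ n)) := by
  refine ⟨fun n => if 2 ≤ m n then
    ((m n : ℝ) / (m n - 1) * (1 + Real.exp (3 / 2 * μ n ^ 2) / (m n - 1)))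
    else 2 * m n / Real.exp (μ n ^ 2), ?_, ?_⟩
  · have hx : Tendsto (fun n => (m n : ℝ)) atTop atTop :=
      tendsto_natCast_atTop_atTop.comp hmtop
    have hinv : Tendsto (fun n => (m n : ℝ)⁻¹) atTop (𝓝 0) := tendsto_inv_atTop_zero.comp hx
    have hsq : Tendsto (fun n => (√(m n : ℝ))⁻¹) atTop (𝓝 0) :=
      tendsto_inv_atTop_zero.comp (Real.tendsto_sqrt_atTop.comp hx)
    have hr : Tendsto (fun n => (m n : ℝ) / (m n - 1)) atTop (𝓝 1) := by
      have : Tendsto (fun n => (1 - (m n : ℝ)⁻¹)⁻¹) atTop (𝓝 1) := by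
        simpa using (hinv.const_sub 1).inv₀ (by norm_num)
      refine this.congr' ?_
      filter_upwards [hx.eventually_ge_atTop 2] with n hn
      have : (m n : ℝ) - 1 ≠ 0 := by linarith
      have : (m n : ℝ) ≠ 0 := by linarith
      field_simp
    have he : Tendsto (fun n => Real.exp (3 / 2 * μ n ^ 2) / (m n - 1)) atTop (𝓝 0) := by
      have hup : Tendsto (fun n => (√(m n : ℝ))⁻¹ * ((m n : ℝ) / (m n - 1))) atTop (𝓝 0) := by
        simpa using hsq.mul hr
      refine squeeze_zero' ?_ ?_ hup
      · filter_upwards [hx.eventually_ge_atTop 2] with n hn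
        exact div_nonneg (Real.exp_nonneg _) (by linarith)
      · filter_upwards [hx.eventually_ge_atTop 2,
          hμo.eventually_le_const (show (0:ℝ) < 1 / 2 by norm_num)] with n hn h
        have hlog : 0 < Real.log (m n) := Real.log_pos (by linarith)
        have hs : 0 < √(Real.log (m n)) := Real.sqrt_pos.2 hlog
        rw [div_le_iff₀ hs] at h
        have h2 : μ n ^ 2 ≤ 1 / 4 * Real.log (m n) := by
          have := pow_le_pow_left₀ (hμpos n).le h 2
          rw [mul_pow, Real.sq_sqrt hlog.le] at this
          linarith
        have h3 : Real.exp (3 / 2 * μ n ^ 2) ≤ √(m n : ℝ) := by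
          rw [Real.sqrt_eq_rpow, Real.rpow_def_of_pos (by linarith)]
          apply Real.exp_le_exp.2
          linarith
        rw [← mul_div_assoc]
        apply div_le_div_of_nonneg_right _ (by linarith)
        have hsm : 0 < √(m n : ℝ) := Real.sqrt_pos.2 (by linarith)
        rw [inv_mul_eq_div, Real.div_sqrt]
        exact h3
    have : Tendsto (fun n => (m n : ℝ) / (m n - 1) * (1 + Real.exp (3 / 2 * μ n ^ 2) / (m n - 1)))
        atTop (𝓝 1) := by
      simpa using hr.mul (he.const_add 1)
    refine this.congr' ?_
    filter_upwards [hmtop.eventually_ge_atTop 2] with n hn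
    rw [if_pos hn]
  · intro n
    dsimp only
    split_ifs with h
    · exact bayes_lower (m n) h (μ n)
    · have : (0:ℝ) < m n := by exact_mod_cast hm1 n
      have h0 : (1 - 2 * (m n : ℝ) / Real.exp (μ n ^ 2) * Real.exp (μ n ^ 2) / (2 * m n)) = 0 := by
        have := Real.exp_pos (μ n ^ 2)
        field_simp
        simp
      rw [h0]
      simp
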